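/- arXiv:1905.00457 — 4 statements merged into one kernel-verified Lean document; each statement's English description precedes it below -/
import Mathlib

section
/- Let m = 2. An anonymous and continuous budget aggregation mechanism A is incentive compatible if and only if there exist real numbers α_0 ≥ α_1 ≥ … ≥ α_n in [0,1] such that for every preference profile P, A(P)_1 = med(p̂_{1,1}, …, p̂_{n,1}, α_0, α_1, …, α_n) and A(P)_2 = med(p̂_{1,2}, …, p̂_{n,2}, 1−α_0, 1−α_1, …, 1−α_n). -/
open Finset

/-- `p` is a budget division over `m` alternatives: entries in `[0,1]` summing to `1`. -/
def IsDivision {m : ℕ} (p : Fin m → ℝ) : Prop :=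
  (∀ j, p j ∈ Set.Icc (0 : ℝ) 1) ∧ ∑ j, p j = 1

/-- A valid preference profile: every voter reports a budget division. -/
def IsProfile {n m : ℕ} (P : Fin n → Fin m → ℝ) : Prop :=
  ∀ i, IsDivision (P i)

/-- The ℓ1 distance between two vectors. -/
noncomputable def l1 {m : ℕ} (x y : Fin m → ℝ) : ℝ := ∑ j, |x j - y j|

/-- Median of a list of odd length `2k+1`: its `(k+1)`-st smallest element. -/
noncomputable def medList (l : List ℝ) : ℝ :=
  ((Multiset.ofList l).sort (· ≤ ·)).getD ((l.length - 1) / 2) 0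

/-- Coordinate-wise generalized median on alternative `j`, with phantoms `f k t` and
the voters' reports on alternative `j`. -/
noncomputable def phMed {n m : ℕ} (f : Fin (n + 1) → ℝ → ℝ)
    (P : Fin n → Fin m → ℝ) (t : ℝ) (j : Fin m) : ℝ :=
  medList (List.ofFn (fun k => f k t) ++ List.ofFn (fun i => P i j))

/-- A phantom system for `n` voters: `n+1` continuous, weakly increasing functions
`[0,1] → [0,1]` with `f k 0 = 0`, `f k 1 = 1`, ordered `f 0 ≥ f 1 ≥ ⋯ ≥ f n`. -/
structure IsPhantomSystem (n : ℕ) (f : Fin (n + 1) → ℝ → ℝ) : Prop where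
  cont : ∀ k, ContinuousOn (f k) (Set.Icc 0 1)
  mono : ∀ k, MonotoneOn (f k) (Set.Icc 0 1)
  mem_Icc : ∀ k, ∀ t ∈ Set.Icc (0 : ℝ) 1, f k t ∈ Set.Icc (0 : ℝ) 1
  apply_zero : ∀ k, f k 0 = 0
  apply_one : ∀ k, f k 1 = 1
  ordered : ∀ t ∈ Set.Icc (0 : ℝ) 1, ∀ k l : Fin (n + 1), k ≤ l → f l t ≤ f k t

/-- The normalizing time `t*` at which the coordinate-wise medians sum to `1`. -/
noncomputable def tStar {n m : ℕ} (f : Fin (n + 1) → ℝ → ℝ)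
    (P : Fin n → Fin m → ℝ) : ℝ :=
  sInf {t | t ∈ Set.Icc (0 : ℝ) 1 ∧ ∑ j, phMed f P t j = 1}

/-- The moving phantom mechanism `A^F` defined by the phantom family `f`. -/
noncomputable def AMP {n m : ℕ} (f : Fin (n + 1) → ℝ → ℝ)
    (P : Fin n → Fin m → ℝ) : Fin m → ℝ :=
  fun j => phMed f P (tStar f P) j

/-- The independent-markets phantom system for `n` voters: `f k t = min (t(n-k)) 1`. -/
noncomputable def fIM (n : ℕ) : Fin (n + 1) → ℝ → ℝ :=
  fun k t => min (t * ((n : ℝ) - (k : ℝ))) 1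

/-- The phantom system `F*` for `n` voters, in which the phantoms move to 1 one at a time. -/
noncomputable def fStar (n : ℕ) : Fin (n + 1) → ℝ → ℝ :=
  fun k t => max 0 (min 1 (t * ((n : ℝ) + 1) - (k : ℝ)))

/-- The `j`-th standard unit vector in `ℝ^m`. -/
def unitVec (m : ℕ) (j : Fin m) : Fin m → ℝ := fun k => if k = j then 1 else 0

/-- Incentive compatibility under ℓ1 preferences. -/
def IncentiveCompatible {n m : ℕ} (A : (Fin n → Fin m → ℝ) → (Fin m → ℝ)) : Prop :=
  ∀ P : Fin n → Fin m → ℝ, IsProfile P → ∀ i : Fin n,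
    ∀ ptrue pmis : Fin m → ℝ, IsDivision ptrue → IsDivision pmis →
      l1 (A (Function.update P i ptrue)) ptrue ≤ l1 (A (Function.update P i pmis)) ptrue

/-- Anonymity: the output is invariant under permutations of the voters. -/
def Anonymous {n m : ℕ} (A : (Fin n → Fin m → ℝ) → (Fin m → ℝ)) : Prop :=
  ∀ P : Fin n → Fin m → ℝ, IsProfile P → ∀ σ : Equiv.Perm (Fin n), A (P ∘ σ) = A P

/-- Neutrality: permuting the alternatives in all reports permutes the output likewise. -/
def Neutral {n m : ℕ} (A : (Fin n → Fin m → ℝ) → (Fin m → ℝ)) : Prop :=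
  ∀ P : Fin n → Fin m → ℝ, IsProfile P → ∀ σ : Equiv.Perm (Fin m),
    A (fun i j => P i (σ j)) = fun j => A P (σ j)

/-- Proportionality: on single-minded profiles, alternative `j` gets `n_j / n`. -/
def Proportional {n m : ℕ} (A : (Fin n → Fin m → ℝ) → (Fin m → ℝ)) : Prop :=
  ∀ P : Fin n → Fin m → ℝ, (∀ i, ∃ j, P i = unitVec m j) →
    ∀ j, A P j = (Nat.card {i : Fin n // P i = unitVec m j} : ℝ) / (n : ℝ)

/-- Pareto optimality. -/
def ParetoOptimal {n m : ℕ} (A : (Fin n → Fin m → ℝ) → (Fin m → ℝ)) : Prop :=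
  ∀ P : Fin n → Fin m → ℝ, IsProfile P → ∀ q : Fin m → ℝ, IsDivision q →
    (∃ i, l1 q (P i) < l1 (A P) (P i)) → ∃ i, l1 (A P) (P i) < l1 q (P i)

/-- A mechanism is valid if it maps profiles to budget divisions. -/
def ValidMech {n m : ℕ} (A : (Fin n → Fin m → ℝ) → (Fin m → ℝ)) : Prop :=
  ∀ P, IsProfile P → IsDivision (A P)

/-- `q` maximizes (utilitarian) social welfare for `P`, i.e. minimizes total ℓ1 distance. -/
def MaximizesWelfare {n m : ℕ} (P : Fin n → Fin m → ℝ) (q : Fin m → ℝ) : Prop :=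
  IsDivision q ∧ ∀ q' : Fin m → ℝ, IsDivision q' → ∑ i, l1 (P i) q ≤ ∑ i, l1 (P i) q'

/-- The `k`-th largest entry of `v` (1-indexed); `0` when `k > n`. -/
noncomputable def kthLargest {n : ℕ} (v : Fin n → ℝ) (k : ℕ) : ℝ :=
  (((Multiset.ofList (List.ofFn v)).sort (· ≤ ·)).reverse).getD (k - 1) 0

lemma countP_ofFn_card (n : ℕ) (f : Fin n → ℝ) (p : ℝ → Prop) [DecidablePred p] :
    (List.ofFn f).countP (fun a => decide (p a))
      = (Finset.univ.filter (fun i => p (f i))).card := by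
  induction n with
  | zero => simp
  | succ n ih =>
    rw [List.ofFn_succ, List.countP_cons, ih, Fin.card_filter_univ_succ]
    by_cases h : p (f 0) <;> simp [h, Function.comp_def]

/-- number of list entries satisfying `p` -/
def cnt {n : ℕ} (a : Fin (n + 1) → ℝ) (x : Fin n → ℝ) (p : ℝ → Prop) [DecidablePred p] : ℕ :=
  (Finset.univ.filter (fun i => p (a i))).card + (Finset.univ.filter (fun i => p (x i))).card

lemma countP_append_cnt {n : ℕ} (a : Fin (n + 1) → ℝ) (x : Fin n → ℝ) (p : ℝ → Prop)
    [DecidablePred p] :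
    (List.ofFn a ++ List.ofFn x).countP (fun b => decide (p b)) = cnt a x p := by
  rw [List.countP_append, countP_ofFn_card, countP_ofFn_card, cnt]

lemma med_spec {n : ℕ} (a : Fin (n + 1) → ℝ) (x : Fin n → ℝ) :
    n + 1 ≤ cnt a x (· ≤ medList (List.ofFn a ++ List.ofFn x)) ∧
    n + 1 ≤ cnt a x (medList (List.ofFn a ++ List.ofFn x) ≤ ·) := by
  rw [← countP_append_cnt, ← countP_append_cnt]
  set l := List.ofFn a ++ List.ofFn x with hl
  have hlen : l.length = 2 * n + 1 := by simp [hl]; omega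
  set s := (Multiset.ofList l).sort (· ≤ ·) with hs
  have hperm : s.Perm l := by
    rw [← Multiset.coe_eq_coe, hs, Multiset.sort_eq]
  have hslen : s.length = 2 * n + 1 := by rw [hperm.length_eq, hlen]
  have hsort : s.Pairwise (· ≤ ·) := Multiset.pairwise_sort _ _
  have hlt : n < s.length := by omega
  have hmed : medList l = s[n] := by
    rw [medList, hlen, ← hs]
    have : (2 * n + 1 - 1) / 2 = n := by omega
    rw [this, List.getD_eq_getElem _ _ hlt]
  have hmono : ∀ i j (hi : i < s.length) (hj : j < s.length), i ≤ j → s[i] ≤ s[j] := by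
    intro i j hi hj hij
    rcases hij.eq_or_lt with h | h
    · subst h; exact le_rfl
    · exact List.pairwise_iff_getElem.1 hsort i j hi hj h
  rw [hmed, ← hperm.countP_eq, ← hperm.countP_eq]
  constructor
  · refine le_trans (le_of_eq ?_) ((List.take_sublist (n + 1) s).countP_le)
    rw [List.countP_eq_length.2]
    · rw [List.length_take]; omega
    · intro b hb
      obtain ⟨i, hi, rfl⟩ := List.mem_iff_getElem.1 hb
      rw [List.length_take] at hi
      rw [List.getElem_take]
      exact decide_eq_true (hmono _ _ _ _ (by omega))
  · refine le_trans (le_of_eq ?_) ((List.drop_sublist n s).countP_le)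
    rw [List.countP_eq_length.2]
    · rw [List.length_drop]; omega
    · intro b hb
      obtain ⟨i, hi, rfl⟩ := List.mem_iff_getElem.1 hb
      rw [List.getElem_drop]
      exact decide_eq_true (hmono _ _ _ _ (by omega))

lemma cnt_le {n : ℕ} (a : Fin (n + 1) → ℝ) (x : Fin n → ℝ) (v w : ℝ)
    (hw : n + 1 ≤ cnt a x (· ≤ w)) (hv : n + 1 ≤ cnt a x (v ≤ ·)) : v ≤ w := by
  by_contra! h
  simp only [cnt] at hw hv
  have key : ∀ (k : ℕ) (f : Fin k → ℝ), (Finset.univ.filter (fun i => f i ≤ w)).card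
      + (Finset.univ.filter (fun i => v ≤ f i)).card ≤ k := by
    intro k f
    rw [← Finset.card_union_of_disjoint]
    · exact (Finset.card_le_univ _).trans (by simp)
    · rw [Finset.disjoint_filter]
      intro i _ h1 h2
      linarith
  have h1 := key _ a
  have h2 := key _ x
  omega

lemma med_unique {n : ℕ} (a : Fin (n + 1) → ℝ) (x : Fin n → ℝ) (v : ℝ)
    (h1 : n + 1 ≤ cnt a x (· ≤ v)) (h2 : n + 1 ≤ cnt a x (v ≤ ·)) :
    v = medList (List.ofFn a ++ List.ofFn x) :=
  le_antisymm (cnt_le a x _ _ (med_spec a x).1 h2) (cnt_le a x _ _ h1 (med_spec a x).2)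

lemma med_compl {n : ℕ} (a : Fin (n + 1) → ℝ) (x : Fin n → ℝ) :
    1 - medList (List.ofFn a ++ List.ofFn x) =
      medList (List.ofFn (fun k => 1 - a k) ++ List.ofFn (fun i => 1 - x i)) := by
  obtain ⟨h1, h2⟩ := med_spec a x
  apply med_unique
  · simpa only [cnt, sub_le_sub_iff_left] using h2
  · simpa only [cnt, sub_le_sub_iff_left] using h1

lemma cnt_mono {n : ℕ} (a : Fin (n + 1) → ℝ) (x y : Fin n → ℝ) (p : ℝ → Prop)
    [DecidablePred p] (h : ∀ i, p (x i) → p (y i)) : cnt a x p ≤ cnt a y p := by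
  unfold cnt
  refine Nat.add_le_add_left (Finset.card_le_card ?_) _
  intro i
  simpa using h i

lemma med_ic {n : ℕ} (a : Fin (n + 1) → ℝ) (x : Fin n → ℝ) (i : Fin n) (t s : ℝ) :
    |medList (List.ofFn a ++ List.ofFn (Function.update x i t)) - t| ≤
    |medList (List.ofFn a ++ List.ofFn (Function.update x i s)) - t| := by
  obtain ⟨h1, h2⟩ := med_spec a (Function.update x i t)
  obtain ⟨h3, h4⟩ := med_spec a (Function.update x i s)
  set v := medList (List.ofFn a ++ List.ofFn (Function.update x i t))
  set w := medList (List.ofFn a ++ List.ofFn (Function.update x i s))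
  rcases lt_trichotomy v t with h | h | h
  · have : w ≤ v := by
      refine cnt_le a _ _ _ (h1.trans (cnt_mono a _ (Function.update x i s) (· ≤ v) ?_)) h4
      intro j
      by_cases hj : j = i
      · subst hj; simp [h]
      · simp [hj]
    rw [abs_of_neg (by linarith), abs_of_neg (by linarith)]; linarith
  · simp [h]
  · have : v ≤ w := by
      refine cnt_le a _ _ _ h3 (h2.trans (cnt_mono a _ (Function.update x i s) (v ≤ ·) ?_))
      intro j
      by_cases hj : j = i
      · subst hj; simp [h]
      · simp [hj]
    rw [abs_of_pos (by linarith), abs_of_pos (by linarith)]; linarith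

lemma oneD (g : ℝ → ℝ) (hg : ContinuousOn g (Set.Icc 0 1))
    (hI : ∀ t ∈ Set.Icc (0 : ℝ) 1, g t ∈ Set.Icc (0 : ℝ) 1)
    (hic : ∀ t ∈ Set.Icc (0 : ℝ) 1, ∀ s ∈ Set.Icc (0 : ℝ) 1, |g t - t| ≤ |g s - t|)
    (t : ℝ) (ht : t ∈ Set.Icc (0 : ℝ) 1) :
    g 0 ≤ g t ∧ g t ≤ g 1 ∧ (g t < t → g 1 ≤ g t) ∧ (t < g t → g t ≤ g 0) := by
  have m0 : (0 : ℝ) ∈ Set.Icc (0 : ℝ) 1 := by simp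
  have m1 : (1 : ℝ) ∈ Set.Icc (0 : ℝ) 1 := by simp
  have a0 : ∀ s ∈ Set.Icc (0 : ℝ) 1, g 0 ≤ g s := by
    intro s hs
    have := hic 0 m0 s hs
    rwa [sub_zero, sub_zero, abs_of_nonneg (hI 0 m0).1, abs_of_nonneg (hI s hs).1] at this
  have a1 : ∀ s ∈ Set.Icc (0 : ℝ) 1, g s ≤ g 1 := by
    intro s hs
    have := hic 1 m1 s hs
    rw [abs_of_nonpos (by linarith [(hI 1 m1).2]), abs_of_nonpos (by linarith [(hI s hs).2])] at this
    linarith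
  have ivt : g 0 ≤ t → t ≤ g 1 → g t = t := by
    intro h0 h1
    obtain ⟨s, hs, hst⟩ := intermediate_value_Icc (by norm_num : (0 : ℝ) ≤ 1) hg ⟨h0, h1⟩
    have := hic t ht s hs
    rw [hst, sub_self, abs_zero] at this
    have := abs_eq_zero.1 (le_antisymm this (abs_nonneg _))
    linarith
  refine ⟨a0 t ht, a1 t ht, fun h => ?_, fun h => ?_⟩
  · by_contra! hc
    by_cases h1 : t ≤ g 1
    · have := ivt ((a0 t ht).trans h.le) h1
      linarith
    · have := hic t ht 1 m1
      rw [abs_of_neg (by linarith), abs_of_neg (by linarith)] at this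
      linarith
  · by_contra! hc
    by_cases h1 : g 0 ≤ t
    · have := ivt h1 (h.le.trans (a1 t ht))
      linarith
    · have := hic t ht 0 m0
      rw [abs_of_pos (by linarith), abs_of_pos (by linarith)] at this
      linarith

/-- Moulin's theorem for one-dimensional rules on the cube. -/
lemma moulin_core (n : ℕ) (G : (Fin n → ℝ) → ℝ)
    (hI : ∀ x, (∀ i, x i ∈ Set.Icc (0 : ℝ) 1) → G x ∈ Set.Icc (0 : ℝ) 1)
    (hanon : ∀ x, (∀ i, x i ∈ Set.Icc (0 : ℝ) 1) → ∀ σ : Equiv.Perm (Fin n), G (x ∘ σ) = G x)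
    (hs : ∀ x, (∀ i, x i ∈ Set.Icc (0 : ℝ) 1) → ∀ i,
      G (Function.update x i 0) ≤ G x ∧ G x ≤ G (Function.update x i 1) ∧
      (G x < x i → G (Function.update x i 1) ≤ G x) ∧
      (x i < G x → G x ≤ G (Function.update x i 0))) :
    ∃ α : Fin (n + 1) → ℝ, (∀ k, α k ∈ Set.Icc (0 : ℝ) 1) ∧
        (∀ k l : Fin (n + 1), k ≤ l → α l ≤ α k) ∧
        ∀ x, (∀ i, x i ∈ Set.Icc (0 : ℝ) 1) →
          G x = medList (List.ofFn α ++ List.ofFn x) := by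
  let e : ℕ → Fin n → ℝ := fun j i => if i.val < j then 1 else 0
  have he : ∀ (q : Fin n → Prop) [DecidablePred q], ∀ i, (if q i then (1 : ℝ) else 0) ∈ Set.Icc (0 : ℝ) 1 := by
    intro q _ i
    split_ifs <;> simp
  have hmono : Monotone (fun j => G (e j)) := by
    refine monotone_nat_of_le_succ fun j => ?_
    by_cases hj : j < n
    · have h := (hs (e j) (he _) ⟨j, hj⟩).2.1
      have : Function.update (e j) ⟨j, hj⟩ 1 = e (j + 1) := by
        funext i
        by_cases hi : i = ⟨j, hj⟩
        · subst hi; simp [e]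
        · have : i.val ≠ j := fun h => hi (Fin.ext h)
          have h2 : i.val < j ↔ i.val < j + 1 := by omega
          simp [e, hi, h2]
      rwa [this] at h
    · have : e j = e (j + 1) := by
        funext i
        have := i.isLt
        simp only [e]
        rw [if_pos (by omega), if_pos (by omega)]
      exact (congrArg G this).le
  have hind : ∀ (q : Fin n → Prop) [DecidablePred q],
      G (fun i => if q i then 1 else 0) = G (e (Finset.univ.filter q).card) := by
    intro q _
    set c := (Finset.univ.filter q).card with hc
    have hcn : c ≤ n := by simpa using Finset.card_le_univ (Finset.univ.filter q)
    have hcard : Fintype.card {i : Fin n // i.val < c} = Fintype.card {i // q i} := by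
      rw [Fintype.card_subtype, Fintype.card_subtype, Fin.card_filter_val_lt, ← hc]
      omega
    let E := Fintype.equivOfCardEq hcard
    rw [← hanon _ (he q) E.extendSubtype]
    congr 1
    funext i
    simp only [Function.comp, e]
    by_cases hi : i.val < c
    · rw [if_pos hi, if_pos (E.extendSubtype_mem i hi)]
    · rw [if_neg hi, if_neg (E.extendSubtype_not_mem i hi)]
  have hmono' : ∀ {a b : ℕ}, a ≤ b → G (e a) ≤ G (e b) := fun h => hmono h
  refine ⟨fun k => G (e (n - k.val)), fun k => hI _ (he _), fun k l hkl => hmono' ?_, ?_⟩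
  · have : k.val ≤ l.val := hkl
    omega
  intro x hx
  set v := G x with hv
  have hmix : ∀ (S : Finset (Fin n)) (q : Fin n → Prop) [DecidablePred q], ∀ i,
      (if i ∈ S then (if q i then (1 : ℝ) else 0) else x i) ∈ Set.Icc (0 : ℝ) 1 := by
    intro S q _ i
    split_ifs
    · simp
    · simp
    · exact hx i
  have hupd : ∀ (S : Finset (Fin n)) (q : Fin n → Prop) [DecidablePred q] (a : Fin n),
      (fun i => if i ∈ insert a S then (if q i then (1 : ℝ) else 0) else x i) =
      Function.update (fun i => if i ∈ S then (if q i then (1 : ℝ) else 0) else x i) a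
        (if q a then 1 else 0) := by
    intro S q _ a
    funext i
    by_cases hi : i = a
    · subst hi; simp
    · simp [hi]
  have hlow : ∀ S : Finset (Fin n),
      G (fun i => if i ∈ S then (if v < x i then (1 : ℝ) else 0) else x i) ≤ v := by
    intro S
    induction S using Finset.induction_on with
    | empty => simp [hv]
    | insert a S ha ih =>
      rw [hupd]
      have h := hs _ (hmix S (fun i => v < x i)) a
      by_cases hq : v < x a
      · rw [if_pos hq]
        refine (h.2.2.1 ?_).trans ih
        rw [if_neg ha]
        exact ih.trans_lt hq
      · rw [if_neg hq]
        exact h.1.trans ih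
  have hhigh : ∀ S : Finset (Fin n),
      v ≤ G (fun i => if i ∈ S then (if v ≤ x i then (1 : ℝ) else 0) else x i) := by
    intro S
    induction S using Finset.induction_on with
    | empty => simp [hv]
    | insert a S ha ih =>
      rw [hupd]
      have h := hs _ (hmix S (fun i => v ≤ x i)) a
      by_cases hq : v ≤ x a
      · rw [if_pos hq]
        exact ih.trans h.2.1
      · rw [if_neg hq]
        refine ih.trans (h.2.2.2 ?_)
        rw [if_neg ha]
        exact (not_le.1 hq).trans_le ih
  have h1 := hlow Finset.univ
  have h2 := hhigh Finset.univ
  simp only [Finset.mem_univ, if_true] at h1 h2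
  rw [hind] at h1 h2
  apply med_unique
  · have hA : (Finset.univ.filter (fun i => v < x i)).card
        + (Finset.univ.filter (fun i => x i ≤ v)).card = n := by
      have := Finset.card_filter_add_card_filter_not (s := (Finset.univ : Finset (Fin n))) (fun i => v < x i)
      simpa using this
    set b := (Finset.univ.filter (fun i => v < x i)).card
    have hB : b + 1 ≤ (Finset.univ.filter (fun k : Fin (n + 1) => G (e (n - k.val)) ≤ v)).card := by
      have hsub : Finset.Ici (⟨n - b, by omega⟩ : Fin (n + 1)) ⊆
          Finset.univ.filter (fun k : Fin (n + 1) => G (e (n - k.val)) ≤ v) := by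
        intro k hk
        have hk0 := Finset.mem_Ici.1 hk
        have hk' : n - b ≤ k.val := hk0
        simp only [Finset.mem_filter, Finset.mem_univ, true_and]
        exact (hmono' (by omega)).trans h1
      have := Finset.card_le_card hsub
      rw [Fin.card_Ici] at this
      simp only at this
      omega
    simp only [cnt]
    omega
  · set c := (Finset.univ.filter (fun i => v ≤ x i)).card with hc
    have hcn : c ≤ n := by simpa using Finset.card_le_univ (Finset.univ.filter (fun i => v ≤ x i))
    have hB : n - c + 1 ≤ (Finset.univ.filter (fun k : Fin (n + 1) => v ≤ G (e (n - k.val)))).card := by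
      have hsub : Finset.Iic (⟨n - c, by omega⟩ : Fin (n + 1)) ⊆
          Finset.univ.filter (fun k : Fin (n + 1) => v ≤ G (e (n - k.val))) := by
        intro k hk
        have hk0 := Finset.mem_Iic.1 hk
        have hk' : k.val ≤ n - c := hk0
        simp only [Finset.mem_filter, Finset.mem_univ, true_and]
        exact h2.trans (hmono' (by omega))
      have := Finset.card_le_card hsub
      rw [Fin.card_Iic] at this
      simpa using this
    simp only [cnt]
    omega

lemma div_snd {p : Fin 2 → ℝ} (h : IsDivision p) : p 1 = 1 - p 0 := by
  have := h.2
  rw [Fin.sum_univ_two] at this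
  linarith

lemma l1_two {p q : Fin 2 → ℝ} (hp : IsDivision p) (hq : IsDivision q) :
    l1 p q = 2 * |p 0 - q 0| := by
  rw [l1, Fin.sum_univ_two, div_snd hp, div_snd hq]
  have : 1 - p 0 - (1 - q 0) = -(p 0 - q 0) := by ring
  rw [this, abs_neg]; ring

/-- the division with first entry `t` -/
def toDiv (t : ℝ) : Fin 2 → ℝ := ![t, 1 - t]

lemma toDiv_isDivision {t : ℝ} (h : t ∈ Set.Icc (0 : ℝ) 1) : IsDivision (toDiv t) := by
  obtain ⟨h0, h1⟩ := h
  refine ⟨fun j => ?_, ?_⟩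
  · fin_cases j
    · exact ⟨h0, h1⟩
    · simp [toDiv, h0, h1]
  · simp [toDiv, Fin.sum_univ_two]

lemma toDiv_eq {p : Fin 2 → ℝ} (h : IsDivision p) : toDiv (p 0) = p := by
  funext j
  fin_cases j
  · rfl
  · simp [toDiv, div_snd h]

lemma isProfile_update {n : ℕ} {P : Fin n → Fin 2 → ℝ} (hP : IsProfile P) (i : Fin n)
    {p : Fin 2 → ℝ} (hp : IsDivision p) : IsProfile (Function.update P i p) := by
  intro j
  by_cases hj : j = i
  · subst hj; simpa using hp
  · simpa [hj] using hP j

/-- Moulin's characterization for `m = 2`: an anonymous, continuous budget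
aggregation mechanism is incentive compatible iff it is a generalized median with `n+1`
ordered phantoms `α₀ ≥ α₁ ≥ ⋯ ≥ αₙ` in `[0,1]`. -/
theorem moulin_characterization (n : ℕ) (hn : 1 ≤ n)
    (A : (Fin n → Fin 2 → ℝ) → (Fin 2 → ℝ)) (hA : ValidMech A)
    (hanon : Anonymous A) (hcont : ContinuousOn A {P | IsProfile P}) :
    IncentiveCompatible A ↔
      ∃ α : Fin (n + 1) → ℝ, (∀ k, α k ∈ Set.Icc (0 : ℝ) 1) ∧
        (∀ k l : Fin (n + 1), k ≤ l → α l ≤ α k) ∧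
        ∀ P : Fin n → Fin 2 → ℝ, IsProfile P →
          A P 0 = medList (List.ofFn α ++ List.ofFn (fun i => P i 0)) ∧
          A P 1 = medList (List.ofFn (fun k => 1 - α k) ++ List.ofFn (fun i => P i 1)) := by
  constructor
  · intro hic
    have hprof : ∀ x : Fin n → ℝ, (∀ i, x i ∈ Set.Icc (0 : ℝ) 1) →
        IsProfile (fun i => toDiv (x i)) := fun x hx i => toDiv_isDivision (hx i)
    obtain ⟨α, h1, h2, h3⟩ := moulin_core n (fun x => A (fun i => toDiv (x i)) 0)
      (fun x hx => (hA _ (hprof x hx)).1 0)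
      (fun x hx σ => congrFun (hanon _ (hprof x hx) σ) 0)
      (by
        intro x hx i
        have hupd : ∀ t, (fun j => toDiv (Function.update x i t j)) =
            Function.update (fun j => toDiv (x j)) i (toDiv t) := by
          intro t
          funext j
          by_cases hj : j = i
          · subst hj; simp
          · simp [hj]
        have hpu : ∀ t ∈ Set.Icc (0 : ℝ) 1,
            IsProfile (Function.update (fun j => toDiv (x j)) i (toDiv t)) :=
          fun t ht => isProfile_update (hprof x hx) i (toDiv_isDivision ht)
        have key := oneD (fun t => A (Function.update (fun j => toDiv (x j)) i (toDiv t)) 0)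
          (by
            have hc : Continuous (fun t : ℝ =>
                Function.update (fun j => toDiv (x j)) i (toDiv t)) := by
              refine continuous_const.update i ?_
              refine continuous_pi fun j => ?_
              fin_cases j
              · exact continuous_id
              · exact continuous_const.sub continuous_id
            exact (continuous_apply 0).comp_continuousOn
              (hcont.comp hc.continuousOn (fun t ht => hpu t ht)))
          (fun t ht => (hA _ (hpu t ht)).1 0)
          (by
            intro t ht s hs
            have := hic _ (hprof x hx) i _ _ (toDiv_isDivision ht) (toDiv_isDivision hs)
            rw [l1_two (hA _ (hpu t ht)) (toDiv_isDivision ht),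
              l1_two (hA _ (hpu s hs)) (toDiv_isDivision ht)] at this
            have h0 : toDiv t 0 = t := rfl
            rw [h0] at this
            linarith)
          (x i) (hx i)
        simp only [← hupd, Function.update_eq_self] at key
        exact key)
    refine ⟨α, h1, h2, fun P hP => ?_⟩
    have h := h3 (fun i => P i 0) (fun i => (hP i).1 0)
    have hPe : (fun i => toDiv (P i 0)) = P := funext fun i => toDiv_eq (hP i)
    simp only [hPe] at h
    refine ⟨h, ?_⟩
    have : (fun i => P i 1) = fun i => 1 - P i 0 := funext fun i => div_snd (hP i)
    rw [this, ← med_compl, ← h, div_snd (hA P hP)]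
  · rintro ⟨α, -, -, h⟩ P hP i p q hp hq
    have hp' := isProfile_update hP i hp
    have hq' := isProfile_update hP i hq
    rw [l1_two (hA _ hp') hp, l1_two (hA _ hq') hp, (h _ hp').1, (h _ hq').1]
    have hupd : ∀ r : Fin 2 → ℝ, (fun j => Function.update P i r j 0) =
        Function.update (fun j => P j 0) i (r 0) := by
      intro r
      funext j
      by_cases hj : j = i
      · subst hj; simp
      · simp [hj]
    rw [hupd, hupd]
    have := med_ic α (fun j => P j 0) i (p 0) (q 0)
    linarith
end

section
/- For every phantom system F and every preference profile P: (i) the function t ↦ ∑_{j=1}^m med(f_0(t),…,f_n(t), p̂_{1,j},…,p̂_{n,j}) is continuous and weakly increasing on [0,1]; (ii) there exists t ∈ [0,1] at which this sum equals 1; and (iii) any two values of t at which the sum equals 1 yield the same coordinate-wise median vector. Hence the moving phantom mechanism A^F is well-defined. -/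
open Finset

lemma sorted_le_iff (s : List ℝ) (hs : s.Pairwise (· ≤ ·)) (c : ℝ) (k : ℕ) (hk : k < s.length) :
    s.getD k 0 ≤ c ↔ k < s.countP (fun x => decide (x ≤ c)) := by
  induction s generalizing k with
  | nil => simp at hk
  | cons a s ih =>
    rw [List.pairwise_cons] at hs
    obtain ⟨ha, hs⟩ := hs
    by_cases hac : a ≤ c
    · cases k with
      | zero => simp [hac]
      | succ k =>
        have hk' : k < s.length := by simpa using hk
        have := ih hs k hk'
        rw [List.countP_cons_of_pos (by simpa using hac)]
        rw [List.getD_cons_succ, this]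
        omega
    · have h0 : (a :: s).countP (fun x => decide (x ≤ c)) = 0 := by
        rw [List.countP_eq_zero]
        intro x hx
        rcases List.mem_cons.1 hx with rfl | hx
        · simpa using hac
        · have := ha x hx
          simp only [decide_eq_true_eq, not_le] at *
          linarith
      rw [h0]
      constructor
      · intro h
        exfalso
        rw [List.getD_eq_getElem _ _ hk] at h
        have hm := List.getElem_mem hk
        rcases List.mem_cons.1 hm with h1 | h1
        · rw [h1] at h; exact hac h
        · exact hac ((ha _ h1).trans h)
      · intro h; omega

lemma medList_le_iff (l : List ℝ) (hl : l ≠ []) (c : ℝ) :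
    medList l ≤ c ↔ (l.length - 1) / 2 < l.countP (fun x => decide (x ≤ c)) := by
  have hpos : 0 < l.length := List.length_pos_iff.2 hl
  unfold medList
  rw [sorted_le_iff _ (Multiset.pairwise_sort _ _) c _ (by
    rw [Multiset.length_sort, Multiset.coe_card]; omega)]
  have hp : List.Perm ((Multiset.ofList l).sort (· ≤ ·)) l := by
    rw [← Multiset.coe_eq_coe, Multiset.sort_eq]
  rw [hp.countP_eq]

lemma medList_le_add {l l' : List ℝ} (e : ℝ) (hl : l ≠ [])
    (h : List.Forall₂ (fun a b => a ≤ b + e) l l') : medList l ≤ medList l' + e := by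
  have hlen := h.length_eq
  have hl' : l' ≠ [] := by
    rintro rfl
    exact hl (by simpa using hlen)
  have h1 := (medList_le_iff l' hl' _).1 le_rfl
  rw [medList_le_iff l hl, hlen]
  refine lt_of_lt_of_le h1 ?_
  generalize medList l' = c
  clear h1 hl hl' hlen
  induction h with
  | nil => simp
  | cons hab _ ih =>
    rw [List.countP_cons, List.countP_cons]
    split_ifs with h1 h2
    · omega
    · simp only [decide_eq_true_eq] at h1 h2
      exact absurd (by linarith) h2
    · omega
    · omega

lemma phMed_le_add {n m : ℕ} (f : Fin (n + 1) → ℝ → ℝ) (P : Fin n → Fin m → ℝ)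
    (s t e : ℝ) (he : 0 ≤ e) (h : ∀ k, f k s ≤ f k t + e) (j : Fin m) :
    phMed f P s j ≤ phMed f P t j + e := by
  unfold phMed
  apply medList_le_add
  · simp
  · apply List.rel_append
    · rw [List.forall₂_iff_get]
      refine ⟨by simp, ?_⟩
      intro i h1 h2
      simp only [List.get_eq_getElem, List.getElem_ofFn]
      exact h _
    · rw [List.forall₂_iff_get]
      refine ⟨by simp, ?_⟩
      intro i h1 h2
      simpa using he

lemma phMed_zero_le {n m : ℕ} {f : Fin (n + 1) → ℝ → ℝ} (hf : IsPhantomSystem n f)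
    (P : Fin n → Fin m → ℝ) (j : Fin m) : phMed f P 0 j ≤ 0 := by
  unfold phMed
  rw [medList_le_iff _ (by simp), List.countP_append]
  have : (List.ofFn (fun k => f k 0)).countP (fun x => decide (x ≤ 0)) = n + 1 := by
    rw [List.countP_eq_length.2]
    · simp
    · intro a ha
      rw [List.mem_ofFn] at ha
      obtain ⟨k, rfl⟩ := ha
      simp [hf.apply_zero]
  rw [this]
  simp only [List.length_append, List.length_ofFn]
  omega

lemma one_le_phMed {n m : ℕ} {f : Fin (n + 1) → ℝ → ℝ} (hf : IsPhantomSystem n f)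
    (P : Fin n → Fin m → ℝ) (j : Fin m) : 1 ≤ phMed f P 1 j := by
  by_contra hlt
  push Not at hlt
  obtain ⟨c, hc, hc1⟩ := exists_between hlt
  have h := hc.le
  unfold phMed at h
  rw [medList_le_iff _ (by simp), List.countP_append] at h
  have h0 : (List.ofFn (fun k => f k 1)).countP (fun x => decide (x ≤ c)) = 0 := by
    rw [List.countP_eq_zero]
    intro a ha
    rw [List.mem_ofFn] at ha
    obtain ⟨k, rfl⟩ := ha
    simp [hf.apply_one, hc1]
  have h1 := List.countP_le_length (p := fun x => decide (x ≤ c)) (l := List.ofFn (fun i => P i j))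
  rw [h0] at h
  simp only [List.length_append, List.length_ofFn] at h h1
  omega

lemma phMed_mono {n m : ℕ} {f : Fin (n + 1) → ℝ → ℝ} (hf : IsPhantomSystem n f)
    (P : Fin n → Fin m → ℝ) (j : Fin m) :
    MonotoneOn (fun t => phMed f P t j) (Set.Icc 0 1) := by
  intro s hs t ht hst
  have := phMed_le_add f P s t 0 le_rfl (fun k => by simpa using hf.mono k hs ht hst) j
  simpa using this

lemma phMed_cont {n m : ℕ} {f : Fin (n + 1) → ℝ → ℝ} (hf : IsPhantomSystem n f)
    (P : Fin n → Fin m → ℝ) (j : Fin m) :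
    ContinuousOn (fun t => phMed f P t j) (Set.Icc 0 1) := by
  intro t ht
  rw [ContinuousWithinAt, Metric.tendsto_nhds]
  intro e he
  have h : ∀ k, ∀ᶠ s in nhdsWithin t (Set.Icc 0 1), dist (f k s) (f k t) < e / 2 := fun k =>
    Metric.tendsto_nhds.1 (hf.cont k t ht) (e / 2) (by linarith)
  filter_upwards [Filter.eventually_all.2 h] with s hs
  have h1 := phMed_le_add f P s t (e / 2) (by linarith) (fun k => by
    have := (abs_lt.1 (hs k)).2; linarith) j
  have h2 := phMed_le_add f P t s (e / 2) (by linarith) (fun k => by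
    have := (abs_lt.1 (hs k)).1; linarith) j
  rw [Real.dist_eq, abs_lt]
  constructor <;> linarith

/-- for every phantom system and profile, the sum of coordinate-wise medians
is continuous and weakly increasing in `t` on `[0,1]`, attains the value `1` at some
`t ∈ [0,1]`, and any two normalizing times yield the same coordinate-wise median vector;
hence the moving phantom mechanism is well-defined. -/
theorem moving_phantom_well_defined (n m : ℕ) (hn : 1 ≤ n) (hm : 2 ≤ m)
    (f : Fin (n + 1) → ℝ → ℝ) (hf : IsPhantomSystem n f)
    (P : Fin n → Fin m → ℝ) (hP : IsProfile P) :
    ContinuousOn (fun t => ∑ j, phMed f P t j) (Set.Icc 0 1) ∧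
    MonotoneOn (fun t => ∑ j, phMed f P t j) (Set.Icc 0 1) ∧
    (∃ t ∈ Set.Icc (0 : ℝ) 1, ∑ j, phMed f P t j = 1) ∧
    (∀ t ∈ Set.Icc (0 : ℝ) 1, ∀ t' ∈ Set.Icc (0 : ℝ) 1,
      ∑ j, phMed f P t j = 1 → ∑ j, phMed f P t' j = 1 →
      ∀ j, phMed f P t j = phMed f P t' j) := by
  have hc : ContinuousOn (fun t => ∑ j, phMed f P t j) (Set.Icc 0 1) :=
    continuousOn_finsetSum _ (fun j _ => phMed_cont hf P j)
  have key : ∀ t ∈ Set.Icc (0 : ℝ) 1, ∀ t' ∈ Set.Icc (0 : ℝ) 1, t ≤ t' →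
      ∑ j, phMed f P t j = 1 → ∑ j, phMed f P t' j = 1 →
      ∀ j, phMed f P t j = phMed f P t' j := by
    intro t ht t' ht' htt h h' j
    exact (Finset.sum_eq_sum_iff_of_le (fun j _ => phMed_mono hf P j ht ht' htt)).1
      (h.trans h'.symm) j (Finset.mem_univ j)
  refine ⟨hc, ?_, ?_, ?_⟩
  · intro s hs t ht hst
    exact Finset.sum_le_sum (fun j _ => phMed_mono hf P j hs ht hst)
  · have h0 : ∑ j, phMed f P 0 j ≤ 0 := Finset.sum_nonpos (fun j _ => phMed_zero_le hf P j)
    have h1 : (m : ℝ) ≤ ∑ j, phMed f P 1 j := by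
      have := Finset.sum_le_sum (fun j (_ : j ∈ Finset.univ) => one_le_phMed hf P j)
      simpa using this
    have hm' : (2 : ℝ) ≤ m := by exact_mod_cast hm
    obtain ⟨t, ht, h⟩ := intermediate_value_Icc zero_le_one hc
      (show (1 : ℝ) ∈ Set.Icc _ _ from ⟨by linarith, by linarith⟩)
    exact ⟨t, ht, h⟩
  · intro t ht t' ht' h h' j
    rcases le_total t t' with htt | htt
    · exact key t ht t' ht' htt h h' j
    · exact (key t' ht' t ht htt h' h j).symm
end

section
/- For m = 2, a budget aggregation mechanism A satisfies anonymity, neutrality, continuity, and incentive compatibility if and only if there exists a phantom system F such that A coincides with the moving phantom mechanism A^F on all preference profiles. -/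
open Finset

/-! ### Medians -/

lemma le_medList (l : List ℝ) (k : ℕ) (hl : l.length = 2 * k + 1) (c : ℝ) :
    c ≤ medList l ↔ k + 1 ≤ l.countP (fun y => decide (c ≤ y)) := by
  unfold medList
  set s := (Multiset.ofList l).sort (· ≤ ·) with hs
  have hperm : s.Perm l := by
    rw [← Multiset.coe_eq_coe, hs, Multiset.sort_eq]
  have hlen : s.length = 2 * k + 1 := by rw [hperm.length_eq, hl]
  have hsort : s.Pairwise (· ≤ ·) := Multiset.pairwise_sort _ _
  have hmono : ∀ i j (hi : i < s.length) (hj : j < s.length), i ≤ j → s[i] ≤ s[j] := by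
    intro i j hi hj hij
    rcases Nat.lt_or_ge i j with h | h
    · exact (List.pairwise_iff_getElem.1 hsort) i j hi hj h
    · have : i = j := by omega
      subst this; exact le_rfl
  rw [← hperm.countP_eq]
  have hk : (l.length - 1) / 2 = k := by omega
  rw [hk, List.getD_eq_getElem _ _ (by omega : k < s.length)]
  constructor
  · intro h
    have h1 : (s.drop k).countP (fun y => decide (c ≤ y)) = (s.drop k).length := by
      rw [List.countP_eq_length]
      intro a ha
      obtain ⟨i, hi, rfl⟩ := List.getElem_of_mem ha
      rw [List.getElem_drop]
      simp only [decide_eq_true_eq]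
      exact h.trans (hmono _ _ _ _ (by omega))
    have h2 := (List.drop_sublist k s).countP_le (p := fun y => decide (c ≤ y))
    rw [h1, List.length_drop] at h2
    omega
  · intro h
    by_contra hc
    rw [← List.take_append_drop (k+1) s, List.countP_append] at h
    have h1 : (s.take (k+1)).countP (fun y => decide (c ≤ y)) = 0 := by
      rw [List.countP_eq_zero]
      intro a ha
      obtain ⟨i, hi, rfl⟩ := List.getElem_of_mem ha
      rw [List.getElem_take]
      simp only [decide_eq_true_eq]
      intro h3
      have hi' : i < k + 1 := by
        rw [List.length_take] at hi; omega
      exact hc (h3.trans (hmono _ _ _ _ (by omega)))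
    have h2 := List.countP_le_length (p := fun y => decide (c ≤ y)) (l := s.drop (k+1))
    rw [List.length_drop] at h2
    omega

lemma medList_le (l : List ℝ) (k : ℕ) (hl : l.length = 2 * k + 1) (c : ℝ) :
    medList l ≤ c ↔ k + 1 ≤ l.countP (fun y => decide (y ≤ c)) := by
  unfold medList
  set s := (Multiset.ofList l).sort (· ≤ ·) with hs
  have hperm : s.Perm l := by
    rw [← Multiset.coe_eq_coe, hs, Multiset.sort_eq]
  have hlen : s.length = 2 * k + 1 := by rw [hperm.length_eq, hl]
  have hsort : s.Pairwise (· ≤ ·) := Multiset.pairwise_sort _ _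
  have hmono : ∀ i j (hi : i < s.length) (hj : j < s.length), i ≤ j → s[i] ≤ s[j] := by
    intro i j hi hj hij
    rcases Nat.lt_or_ge i j with h | h
    · exact (List.pairwise_iff_getElem.1 hsort) i j hi hj h
    · have : i = j := by omega
      subst this; exact le_rfl
  rw [← hperm.countP_eq]
  have hk : (l.length - 1) / 2 = k := by omega
  rw [hk, List.getD_eq_getElem _ _ (by omega : k < s.length)]
  constructor
  · intro h
    have h1 : (s.take (k+1)).countP (fun y => decide (y ≤ c)) = (s.take (k+1)).length := by
      rw [List.countP_eq_length]
      intro a ha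
      obtain ⟨i, hi, rfl⟩ := List.getElem_of_mem ha
      rw [List.getElem_take]
      simp only [decide_eq_true_eq]
      have hi' : i < k + 1 := by
        rw [List.length_take] at hi; omega
      exact (hmono _ _ _ _ (by omega)).trans h
    have h2 := (List.take_sublist (k+1) s).countP_le (p := fun y => decide (y ≤ c))
    rw [h1, List.length_take] at h2
    omega
  · intro h
    by_contra hc
    rw [← List.take_append_drop k s, List.countP_append] at h
    have h1 : (s.drop k).countP (fun y => decide (y ≤ c)) = 0 := by
      rw [List.countP_eq_zero]
      intro a ha
      obtain ⟨i, hi, rfl⟩ := List.getElem_of_mem ha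
      rw [List.getElem_drop]
      simp only [decide_eq_true_eq]
      intro h3
      exact hc ((hmono _ _ _ _ (by omega)).trans h3)
    have h2 := List.countP_le_length (p := fun y => decide (y ≤ c)) (l := s.take k)
    rw [List.length_take] at h2
    omega

/-- generalized median -/
noncomputable def gmed {n : ℕ} (a : Fin (n + 1) → ℝ) (x : Fin n → ℝ) : ℝ :=
  medList (List.ofFn a ++ List.ofFn x)

lemma countP_ofFn_real {n : ℕ} (x : Fin n → ℝ) (p : ℝ → Prop) [DecidablePred p] :
    (List.ofFn x).countP (fun y => decide (p y)) = #{i | p (x i)} := by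
  rw [List.ofFn_eq_map, List.countP_map, List.countP_eq_length_filter]
  rw [Finset.card_def, Finset.filter_val]
  have : (Finset.univ : Finset (Fin n)).val = (List.finRange n : Multiset (Fin n)) := rfl
  rw [this, Multiset.filter_coe, Multiset.coe_card]
  rfl

lemma le_gmed {n : ℕ} (a : Fin (n + 1) → ℝ) (x : Fin n → ℝ) (c : ℝ) :
    c ≤ gmed a x ↔ n + 1 ≤ #{k | c ≤ a k} + #{i | c ≤ x i} := by
  unfold gmed
  rw [le_medList _ n (by simp; omega), List.countP_append, countP_ofFn_real a (fun y => c ≤ y),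
    countP_ofFn_real x (fun y => c ≤ y)]

lemma gmed_le {n : ℕ} (a : Fin (n + 1) → ℝ) (x : Fin n → ℝ) (c : ℝ) :
    gmed a x ≤ c ↔ n + 1 ≤ #{k | a k ≤ c} + #{i | x i ≤ c} := by
  unfold gmed
  rw [medList_le _ n (by simp; omega), List.countP_append, countP_ofFn_real a (fun y => y ≤ c),
    countP_ofFn_real x (fun y => y ≤ c)]

lemma le_gmed_anti {n : ℕ} (a : Fin (n + 1) → ℝ) (ha : Antitone a) (x : Fin n → ℝ) (c : ℝ)
    (k : Fin (n + 1)) (hk : (k : ℕ) + #{i | c ≤ x i} = n) :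
    c ≤ gmed a x ↔ c ≤ a k := by
  rw [le_gmed]
  constructor
  · intro h
    by_contra hc
    have : ({k | c ≤ a k} : Finset (Fin (n + 1))) ⊆ Finset.Iio k := by
      intro l hl
      simp only [Finset.mem_filter, Finset.mem_univ, true_and] at hl
      rw [Finset.mem_Iio]
      by_contra hlk
      exact hc (hl.trans (ha (not_lt.1 hlk)))
    have := Finset.card_le_card this
    rw [Fin.card_Iio] at this
    omega
  · intro h
    have : Finset.Iic k ⊆ ({k | c ≤ a k} : Finset (Fin (n + 1))) := by
      intro l hl
      rw [Finset.mem_Iic] at hl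
      simp only [Finset.mem_filter, Finset.mem_univ, true_and]
      exact h.trans (ha hl)
    have := Finset.card_le_card this
    rw [Fin.card_Iic] at this
    omega

lemma gmed_le_anti {n : ℕ} (a : Fin (n + 1) → ℝ) (ha : Antitone a) (x : Fin n → ℝ) (c : ℝ)
    (k : Fin (n + 1)) (hk : (k : ℕ) = #{i | x i ≤ c}) :
    gmed a x ≤ c ↔ a k ≤ c := by
  rw [gmed_le]
  have hkn := k.2
  constructor
  · intro h
    by_contra hc
    have : ({k | a k ≤ c} : Finset (Fin (n + 1))) ⊆ Finset.Ioi k := by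
      intro l hl
      simp only [Finset.mem_filter, Finset.mem_univ, true_and] at hl
      rw [Finset.mem_Ioi]
      by_contra hlk
      exact hc ((ha (not_lt.1 hlk)).trans hl)
    have := Finset.card_le_card this
    rw [Fin.card_Ioi] at this
    omega
  · intro h
    have : Finset.Ici k ⊆ ({k | a k ≤ c} : Finset (Fin (n + 1))) := by
      intro l hl
      rw [Finset.mem_Ici] at hl
      simp only [Finset.mem_filter, Finset.mem_univ, true_and]
      exact (ha hl).trans h
    have := Finset.card_le_card this
    rw [Fin.card_Ici] at this
    omega

lemma gmed_perm {n : ℕ} (a : Fin (n + 1) → ℝ) (x : Fin n → ℝ) (σ : Equiv.Perm (Fin (n + 1)))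
    (τ : Equiv.Perm (Fin n)) : gmed (a ∘ σ) (x ∘ τ) = gmed a x := by
  unfold gmed
  have h : ((List.ofFn (a ∘ σ) ++ List.ofFn (x ∘ τ))).Perm (List.ofFn a ++ List.ofFn x) :=
    (Equiv.Perm.ofFn_comp_perm σ a).append (Equiv.Perm.ofFn_comp_perm τ x)
  unfold medList
  rw [Multiset.coe_eq_coe.2 h, h.length_eq]

lemma gmed_reflect {n : ℕ} (a : Fin (n + 1) → ℝ) (x : Fin n → ℝ) :
    gmed (fun k => 1 - a k) (fun i => 1 - x i) = 1 - gmed a x := by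
  apply eq_of_forall_le_iff
  intro c
  rw [le_gmed, le_sub_comm, gmed_le]
  simp only [le_sub_comm (a := c)]

lemma gmed_lip {n : ℕ} (a b : Fin (n + 1) → ℝ) (x y : Fin n → ℝ) (ε : ℝ)
    (ha : ∀ k, a k ≤ b k + ε) (hx : ∀ i, x i ≤ y i + ε) : gmed a x ≤ gmed b y + ε := by
  rw [← sub_le_iff_le_add, le_gmed]
  refine ((le_gmed a x _).1 le_rfl).trans (add_le_add ?_ ?_) <;>
  · apply Finset.card_le_card
    intro k
    simp only [Finset.mem_filter, Finset.mem_univ, true_and]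
    intro h
    first
    | linarith [ha k]
    | linarith [hx k]

lemma gmed_dist {n : ℕ} (p q : (Fin (n + 1) → ℝ) × (Fin n → ℝ)) :
    dist (gmed p.1 p.2) (gmed q.1 q.2) ≤ dist p q := by
  have h1 : ∀ k, |p.1 k - q.1 k| ≤ dist p q := fun k =>
    ((dist_le_pi_dist p.1 q.1 k)).trans (le_max_left _ _)
  have h2 : ∀ k, |p.2 k - q.2 k| ≤ dist p q := fun k =>
    ((dist_le_pi_dist p.2 q.2 k)).trans (le_max_right _ _)
  rw [Real.dist_eq, abs_le]
  have e1 := gmed_lip p.1 q.1 p.2 q.2 (dist p q)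
    (fun k => by linarith [(abs_le.1 (h1 k)).2]) (fun k => by linarith [(abs_le.1 (h2 k)).2])
  have e2 := gmed_lip q.1 p.1 q.2 p.2 (dist p q)
    (fun k => by linarith [(abs_le.1 (h1 k)).1]) (fun k => by linarith [(abs_le.1 (h2 k)).1])
  constructor <;> linarith

lemma gmed_continuous {n : ℕ} :
    Continuous (fun p : (Fin (n + 1) → ℝ) × (Fin n → ℝ) => gmed p.1 p.2) := by
  have : LipschitzWith 1 (fun p : (Fin (n + 1) → ℝ) × (Fin n → ℝ) => gmed p.1 p.2) :=
    LipschitzWith.of_dist_le_mul (fun p q => by simpa using gmed_dist p q)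
  exact this.continuous

lemma gmed_const {n : ℕ} (x : Fin n → ℝ) (c : ℝ) : gmed (fun _ => c) x = c := by
  apply le_antisymm
  · rw [gmed_le]; simp
  · rw [le_gmed]; simp

/-! ### Moving phantoms -/

lemma phMed_eq {n m : ℕ} (f : Fin (n + 1) → ℝ → ℝ) (P : Fin n → Fin m → ℝ) (t : ℝ) (j : Fin m) :
    phMed f P t j = gmed (fun k => f k t) (fun i => P i j) := rfl

lemma tStar_mem {n m : ℕ} (hm : 1 ≤ m) {f : Fin (n + 1) → ℝ → ℝ} (hf : IsPhantomSystem n f)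
    (P : Fin n → Fin m → ℝ) :
    tStar f P ∈ Set.Icc (0 : ℝ) 1 ∧ ∑ j, phMed f P (tStar f P) j = 1 := by
  have hc : ContinuousOn (fun t => ∑ j, phMed f P t j) (Set.Icc 0 1) :=
    continuousOn_finsetSum _ (fun j _ => phMed_cont hf P j)
  have h0 : ∑ j, phMed f P 0 j = 0 := by
    simp only [phMed_eq, hf.apply_zero, gmed_const]; simp
  have h1 : ∑ j, phMed f P 1 j = m := by
    simp only [phMed_eq, hf.apply_one, gmed_const]; simp
  have hcl : IsClosed (Set.Icc (0:ℝ) 1 ∩ (fun t => ∑ j, phMed f P t j) ⁻¹' {1}) :=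
    hc.preimage_isClosed_of_isClosed isClosed_Icc isClosed_singleton
  have hmem := IsClosed.csInf_mem hcl ?_ ⟨0, fun t ht => ht.1.1⟩
  · exact hmem
  · have := intermediate_value_Icc (zero_le_one' ℝ) hc
    have h2 : (1:ℝ) ∈ Set.Icc (∑ j, phMed f P 0 j) (∑ j, phMed f P 1 j) := by
      rw [h0, h1]; exact ⟨zero_le_one, by exact_mod_cast hm⟩
    obtain ⟨t, ht, h⟩ := this h2
    exact ⟨t, ht, h⟩

lemma div_two {p : Fin 2 → ℝ} (hp : IsDivision p) : p 1 = 1 - p 0 := by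
  have := hp.2
  rw [Fin.sum_univ_two] at this
  linarith

lemma AMP_one {n : ℕ} {f : Fin (n + 1) → ℝ → ℝ} (hf : IsPhantomSystem n f)
    (P : Fin n → Fin 2 → ℝ) : AMP f P 1 = 1 - AMP f P 0 := by
  have := (tStar_mem (by norm_num) hf P).2
  rw [Fin.sum_univ_two] at this
  unfold AMP
  linarith

section
variable {n : ℕ} {f : Fin (n + 1) → ℝ → ℝ} (hf : IsPhantomSystem n f)
  (τ : Fin (n + 1) → ℝ) (hτ : ∀ k, τ k ∈ Set.Icc (0 : ℝ) 1)
  (hs : ∀ k, f k (τ k) + f (Fin.rev k) (τ k) = 1)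

lemma cross_between (hf : IsPhantomSystem n f) (hτ : ∀ k, τ k ∈ Set.Icc (0 : ℝ) 1)
  (hs : ∀ k, f k (τ k) + f (Fin.rev k) (τ k) = 1) (k : Fin (n + 1)) (t : ℝ)
    (ht : t ∈ Set.Icc (0 : ℝ) 1) :
    (f k t ≤ f k (τ k) ∧ f k (τ k) ≤ 1 - f (Fin.rev k) t) ∨
    (1 - f (Fin.rev k) t ≤ f k (τ k) ∧ f k (τ k) ≤ f k t) := by
  have := hs k
  rcases le_total t (τ k) with h | h
  · left
    have h1 := hf.mono k ht (hτ k) h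
    have h2 := hf.mono (Fin.rev k) ht (hτ k) h
    constructor <;> linarith
  · right
    have h1 := hf.mono k (hτ k) ht h
    have h2 := hf.mono (Fin.rev k) (hτ k) ht h
    constructor <;> linarith

lemma cross_anti (hf : IsPhantomSystem n f) (hτ : ∀ k, τ k ∈ Set.Icc (0 : ℝ) 1)
  (hs : ∀ k, f k (τ k) + f (Fin.rev k) (τ k) = 1) : Antitone (fun k => f k (τ k)) := by
  intro k l hkl
  have h1 := hf.ordered (τ k) (hτ k) k l hkl
  have h2 := hf.ordered (τ k) (hτ k) (Fin.rev l) (Fin.rev k) (Fin.rev_le_rev.2 hkl)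
  have h3 := hs k
  have := cross_between τ hf hτ hs l (τ k) (hτ k)
  simp only
  rcases this with h | h <;> linarith [h.1, h.2]

lemma cross_symm (hf : IsPhantomSystem n f) (hτ : ∀ k, τ k ∈ Set.Icc (0 : ℝ) 1)
  (hs : ∀ k, f k (τ k) + f (Fin.rev k) (τ k) = 1) (k : Fin (n + 1)) :
    f (Fin.rev k) (τ (Fin.rev k)) = 1 - f k (τ k) := by
  have h3 := hs k
  have := cross_between τ hf hτ hs (Fin.rev k) (τ k) (hτ k)
  rw [Fin.rev_rev] at this
  rcases this with h | h <;> linarith [h.1, h.2]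

lemma AMP_zero (hf : IsPhantomSystem n f) (hτ : ∀ k, τ k ∈ Set.Icc (0 : ℝ) 1)
  (hs : ∀ k, f k (τ k) + f (Fin.rev k) (τ k) = 1) (P : Fin n → Fin 2 → ℝ) (hP : IsProfile P) :
    AMP f P 0 = gmed (fun k => f k (τ k)) (fun i => P i 0) := by
  obtain ⟨ht, hsum⟩ := tStar_mem (by norm_num) hf P
  have e0 : AMP f P 0 = gmed (fun k => f k (tStar f P)) (fun i => P i 0) := rfl
  have e1 : AMP f P 0 = gmed (fun k => 1 - f (Fin.rev k) (tStar f P)) (fun i => P i 0) := by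
    have h1 : AMP f P 1 = gmed (fun k => f k (tStar f P)) (fun i => P i 1) := rfl
    have h2 := AMP_one hf P
    have h3 : (fun i => P i 1) = fun i => 1 - P i 0 := by
      funext i; exact div_two (hP i)
    have h4 := gmed_reflect (fun k => f k (tStar f P)) (fun i => 1 - P i 0)
    have h5 := gmed_perm (fun k => 1 - f k (tStar f P)) (fun i => P i 0) Fin.revPerm 1
    simp only [sub_sub_cancel] at h4
    rw [h3] at h1
    have h6 : AMP f P 0 = 1 - gmed (fun k => f k (tStar f P)) (fun i => 1 - P i 0) := by linarith
    rw [h6, ← h4, ← h5]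
    rfl
  apply eq_of_forall_le_iff
  intro c
  have hk : (n - #{i | c ≤ P i 0}) + #{i | c ≤ P i 0} = n := by
    have := Finset.card_le_univ ({i | c ≤ P i 0} : Finset (Fin n))
    rw [Fintype.card_fin] at this
    omega
  let k : Fin (n + 1) := ⟨n - #{i | c ≤ P i 0}, by omega⟩
  have i1 := le_gmed_anti (fun k => f k (tStar f P))
    (fun k l h => hf.ordered _ ht k l h) (fun i => P i 0) c k hk
  have i2 := le_gmed_anti (fun k => 1 - f (Fin.rev k) (tStar f P))
    (fun k l h => sub_le_sub_left (hf.ordered _ ht _ _ (Fin.rev_le_rev.2 h)) 1)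
      (fun i => P i 0) c k hk
  have i3 := le_gmed_anti (fun k => f k (τ k)) (cross_anti τ hf hτ hs) (fun i => P i 0) c k hk
  rw [← e0] at i1
  rw [← e1] at i2
  rw [i3]
  have := cross_between τ hf hτ hs k _ ht
  constructor
  · intro h
    have j1 := i1.1 h
    have j2 := i2.1 h

    rcases this with h | h <;> linarith [h.1, h.2]
  · intro h

    rcases this with h' | h'
    · exact i2.2 (h.trans h'.2)
    · exact i1.2 (h.trans h'.2)

end

lemma exists_cross {n : ℕ} {f : Fin (n + 1) → ℝ → ℝ} (hf : IsPhantomSystem n f) :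
    ∃ τ : Fin (n + 1) → ℝ, (∀ k, τ k ∈ Set.Icc (0 : ℝ) 1) ∧
      ∀ k, f k (τ k) + f (Fin.rev k) (τ k) = 1 := by
  have : ∀ k, ∃ t, t ∈ Set.Icc (0 : ℝ) 1 ∧ f k t + f (Fin.rev k) t = 1 := by
    intro k
    have := intermediate_value_Icc (zero_le_one' ℝ) ((hf.cont k).add (hf.cont (Fin.rev k)))
    have h2 : (1:ℝ) ∈ Set.Icc (f k 0 + f (Fin.rev k) 0) (f k 1 + f (Fin.rev k) 1) := by
      simp only [hf.apply_zero, hf.apply_one]; norm_num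
    obtain ⟨t, ht, h⟩ := this h2
    exact ⟨t, ht, h⟩
  choose τ h1 h2 using this
  exact ⟨τ, h1, h2⟩

/-- The middle notion: a symmetric generalized median. -/
def IsSymMed {n : ℕ} (A : (Fin n → Fin 2 → ℝ) → (Fin 2 → ℝ)) (α : Fin (n + 1) → ℝ) : Prop :=
  Antitone α ∧ (∀ k, α k ∈ Set.Icc (0:ℝ) 1) ∧ (∀ k, α (Fin.rev k) = 1 - α k) ∧
    ∀ P, IsProfile P → A P 0 = gmed α (fun i => P i 0)

lemma symMed_of_phantom {n : ℕ} (A : (Fin n → Fin 2 → ℝ) → (Fin 2 → ℝ))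
    {f : Fin (n + 1) → ℝ → ℝ} (hf : IsPhantomSystem n f)
    (h : ∀ P, IsProfile P → A P = AMP f P) : ∃ α, IsSymMed A α := by
  obtain ⟨τ, hτ, hs⟩ := exists_cross hf
  refine ⟨fun k => f k (τ k), cross_anti τ hf hτ hs, fun k => hf.mem_Icc k _ (hτ k),
    cross_symm τ hf hτ hs, fun P hP => ?_⟩
  rw [h P hP, AMP_zero τ hf hτ hs P hP]

lemma phantom_of_symMed {n : ℕ} (A : (Fin n → Fin 2 → ℝ) → (Fin 2 → ℝ)) (hA : ValidMech A)
    (α : Fin (n + 1) → ℝ) (h : IsSymMed A α) :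
    ∃ f : Fin (n + 1) → ℝ → ℝ, IsPhantomSystem n f ∧ ∀ P, IsProfile P → A P = AMP f P := by
  obtain ⟨hanti, hmem, hsymm, heq⟩ := h
  let f : Fin (n + 1) → ℝ → ℝ := fun k t => α k * min (2 * t) 1 + (1 - α k) * max (2 * t - 1) 0
  have hf : IsPhantomSystem n f := by
    constructor
    · intro k
      apply Continuous.continuousOn
      fun_prop
    · intro k s _ t _ hst
      have := hmem k
      have h1 : min (2 * s) 1 ≤ min (2 * t) 1 := min_le_min (by linarith) le_rfl
      have h2 : max (2 * s - 1) 0 ≤ max (2 * t - 1) 0 := max_le_max (by linarith) le_rfl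
      exact add_le_add (mul_le_mul_of_nonneg_left h1 this.1)
        (mul_le_mul_of_nonneg_left h2 (by linarith [this.2]))
    · intro k t ht
      obtain ⟨a0, a1⟩ := hmem k
      have h1 : 0 ≤ min (2 * t) 1 := le_min (by linarith [ht.1]) zero_le_one
      have h2 : min (2 * t) 1 ≤ 1 := min_le_right _ _
      have h3 : 0 ≤ max (2 * t - 1) 0 := le_max_right _ _
      have h4 : max (2 * t - 1) 0 ≤ 1 := max_le (by linarith [ht.2]) zero_le_one
      simp only [f]
      constructor
      · have : 0 ≤ 1 - α k := by linarith
        positivity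
      · nlinarith
    · intro k; simp [f]
    · intro k; norm_num [f]
    · intro t ht k l hkl
      have h1 := hanti hkl
      have h2 : max (2 * t - 1) 0 ≤ min (2 * t) 1 := by
        apply max_le <;> apply le_min <;> linarith [ht.1, ht.2]
      simp only [f]
      nlinarith
  refine ⟨f, hf, fun P hP => ?_⟩
  have hhalf : ∀ k, f k (1/2) = α k := by intro k; norm_num [f]
  have h0 : A P 0 = AMP f P 0 := by
    rw [heq P hP, AMP_zero (fun _ => 1/2) hf (fun _ => by constructor <;> norm_num)
      (fun k => by rw [hhalf, hhalf, hsymm]; ring) P hP]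
    simp only [hhalf]
  have h1 : A P 1 = AMP f P 1 := by
    rw [AMP_one hf, ← h0, div_two (hA P hP)]
  funext j
  fin_cases j
  · exact h0
  · exact h1

lemma profile_update {n : ℕ} {P : Fin n → Fin 2 → ℝ} (hP : IsProfile P) (i : Fin n)
    {q : Fin 2 → ℝ} (hq : IsDivision q) : IsProfile (Function.update P i q) := by
  intro j
  by_cases h : j = i
  · subst h; simpa using hq
  · simpa [h] using hP j

lemma gmed_ic {n : ℕ} (α : Fin (n + 1) → ℝ) (x y : Fin n → ℝ) (i : Fin n)
    (h : ∀ j, j ≠ i → x j = y j) : |gmed α x - x i| ≤ |gmed α y - x i| := by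
  rcases lt_trichotomy (x i) (gmed α x) with hi | hi | hi
  · have : gmed α x ≤ gmed α y := by
      rw [le_gmed]
      refine ((le_gmed α x _).1 le_rfl).trans (Nat.add_le_add_left (Finset.card_le_card ?_) _)
      intro j
      simp only [Finset.mem_filter, Finset.mem_univ, true_and]
      intro hj
      have hji : j ≠ i := by rintro rfl; linarith
      rw [← h j hji]; exact hj
    rw [abs_of_pos (by linarith), abs_of_pos (by linarith)]
    linarith
  · rw [hi]; simp
  · have : gmed α y ≤ gmed α x := by
      rw [gmed_le]
      refine ((gmed_le α x _).1 le_rfl).trans (Nat.add_le_add_left (Finset.card_le_card ?_) _)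
      intro j
      simp only [Finset.mem_filter, Finset.mem_univ, true_and]
      intro hj
      have hji : j ≠ i := by rintro rfl; linarith
      rw [← h j hji]; exact hj
    rw [abs_of_neg (by linarith), abs_of_neg (by linarith)]
    linarith

lemma two_ext {p q : Fin 2 → ℝ} (hp : IsDivision p) (hq : IsDivision q) (h : p 0 = q 0) :
    p = q := by
  funext j
  fin_cases j
  · exact h
  · have := div_two hp
    have := div_two hq
    simp only [Fin.mk_one]
    linarith

lemma division_perm {p : Fin 2 → ℝ} (hp : IsDivision p) (σ : Equiv.Perm (Fin 2)) :
    IsDivision (fun j => p (σ j)) :=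
  ⟨fun j => hp.1 _, by rw [Equiv.sum_comp σ p]; exact hp.2⟩

lemma axioms_of_symMed {n : ℕ} (A : (Fin n → Fin 2 → ℝ) → (Fin 2 → ℝ)) (hA : ValidMech A)
    (α : Fin (n + 1) → ℝ) (h : IsSymMed A α) :
    Anonymous A ∧ Neutral A ∧ ContinuousOn A {P | IsProfile P} ∧ IncentiveCompatible A := by
  obtain ⟨hanti, hmem, hsymm, heq⟩ := h
  refine ⟨?_, ?_, ?_, ?_⟩
  · intro P hP σ
    have hP' : IsProfile (P ∘ σ) := fun i => hP _
    apply two_ext (hA _ hP') (hA _ hP)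
    rw [heq _ hP', heq _ hP]
    exact gmed_perm α (fun i => P i 0) 1 σ
  · intro P hP σ
    have hP' : IsProfile (fun i j => P i (σ j)) := fun i => division_perm (hP i) σ
    apply two_ext (hA _ hP') (division_perm (hA _ hP) σ)
    rw [heq _ hP']
    have h01 : σ 0 = 0 ∨ σ 0 = 1 := by omega
    rcases h01 with h | h
    · simp only [h]; rw [heq _ hP]
    · simp only [h]; rw [div_two (hA _ hP), heq _ hP, ← gmed_reflect,
        ← gmed_perm α (fun i => P i 1) Fin.revPerm 1]
      congr 1
      · funext k; exact hsymm k
      · funext i; exact div_two (hP i)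
  · have h0 : ContinuousOn (fun P => A P 0) {P | IsProfile P} := by
      have : Continuous (fun P : Fin n → Fin 2 → ℝ => gmed α (fun i => P i 0)) := by
        have h1 : Continuous (fun P : Fin n → Fin 2 → ℝ =>
          ((α, fun i => P i 0) : (Fin (n + 1) → ℝ) × (Fin n → ℝ))) := by fun_prop
        exact gmed_continuous.comp h1
      exact this.continuousOn.congr (fun P hP => heq P hP)
    rw [continuousOn_pi]
    intro j
    fin_cases j
    · exact h0
    · exact (continuousOn_const.sub h0).congr (fun P hP => div_two (hA P hP))
  · intro P hP i p q hp hq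
    have hp' := profile_update hP i hp
    have hq' := profile_update hP i hq
    rw [l1_two (hA _ hp') hp, l1_two (hA _ hq') hp, heq _ hp', heq _ hq']
    have := gmed_ic α (fun j => Function.update P i p j 0) (fun j => Function.update P i q j 0) i
      (fun j hj => by simp [hj])
    simp only [Function.update_self] at this
    linarith

/-! ### From the axioms to a median -/

lemma update_steps {n : ℕ} (Q : (Fin n → ℝ) → Prop) (x y : Fin n → ℝ)
    (h : ∀ z i, (∀ j, z j = x j ∨ z j = y j) → z i = x i → Q z → Q (Function.update z i (y i)))
    (hx : Q x) : Q y := by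
  have key : ∀ S : Finset (Fin n), Q (fun i => if i ∈ S then y i else x i) := by
    intro S
    induction S using Finset.induction_on with
    | empty => simpa using hx
    | insert i S hi ih =>
      have := h _ i (fun j => by by_cases hj : j ∈ S <;> simp [hj]) (by simp [hi]) ih
      convert this using 1
      funext j
      by_cases hj : j = i
      · subst hj; simp
      · simp [hj]
  simpa using key Finset.univ

lemma one_dim_mono (h : ℝ → ℝ)
    (hic : ∀ x ∈ Set.Icc (0:ℝ) 1, ∀ y ∈ Set.Icc (0:ℝ) 1, |h x - x| ≤ |h y - x|) :
    MonotoneOn h (Set.Icc 0 1) := by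
  intro x hx y hy hxy
  by_contra hc
  push Not at hc
  rcases hxy.lt_or_eq with hlt | rfl
  · have h1 := hic x hx y hy
    have h2 := hic y hy x hx
    rw [← sq_le_sq] at h1 h2
    nlinarith
  · exact lt_irrefl _ hc

lemma one_dim_low (h : ℝ → ℝ) (hc : ContinuousOn h (Set.Icc 0 1))
    (hic : ∀ x ∈ Set.Icc (0:ℝ) 1, ∀ y ∈ Set.Icc (0:ℝ) 1, |h x - x| ≤ |h y - x|)
    (x : ℝ) (hx : x ∈ Set.Icc (0:ℝ) 1) (v : ℝ) (hxv : x < v) (hv : v ≤ h x) : v ≤ h 0 := by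
  by_contra hlt
  push Not at hlt
  have := intermediate_value_Icc hx.1 (hc.mono (Set.Icc_subset_Icc_right hx.2))
  obtain ⟨y, hy, hyw⟩ := this (show max (h 0) x ∈ Set.Icc (h 0) (h x) from
    ⟨le_max_left _ _, max_le (by linarith) (by linarith)⟩)
  have h1 := hic x hx y ⟨hy.1, hy.2.trans hx.2⟩
  have h2 : max (h 0) x < v := max_lt hlt hxv
  have h3 := le_max_right (h 0) x
  rw [hyw, abs_of_pos (by linarith), abs_of_nonneg (by linarith)] at h1
  linarith

lemma one_dim_high (h : ℝ → ℝ) (hc : ContinuousOn h (Set.Icc 0 1))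
    (hic : ∀ x ∈ Set.Icc (0:ℝ) 1, ∀ y ∈ Set.Icc (0:ℝ) 1, |h x - x| ≤ |h y - x|)
    (x : ℝ) (hx : x ∈ Set.Icc (0:ℝ) 1) (v : ℝ) (hxv : v < x) (hv : h x ≤ v) : h 1 ≤ v := by
  by_contra hlt
  push Not at hlt
  have := intermediate_value_Icc hx.2 (hc.mono (Set.Icc_subset_Icc_left hx.1))
  obtain ⟨y, hy, hyw⟩ := this (show min (h 1) x ∈ Set.Icc (h x) (h 1) from
    ⟨le_min (by linarith) (by linarith), min_le_left _ _⟩)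
  have h1 := hic x hx y ⟨hx.1.trans hy.1, hy.2⟩
  have h2 : v < min (h 1) x := lt_min hlt hxv
  have h3 := min_le_right (h 1) x
  rw [hyw, abs_of_neg (by linarith), abs_of_nonpos (by linarith)] at h1
  linarith

/-- embed a vector of first coordinates as a profile -/
def emb {n : ℕ} (x : Fin n → ℝ) : Fin n → Fin 2 → ℝ := fun i => ![x i, 1 - x i]

lemma div_of_mem {a : ℝ} (ha : a ∈ Set.Icc (0:ℝ) 1) : IsDivision ![a, 1 - a] := by
  obtain ⟨h0, h1⟩ := ha
  refine ⟨fun j => ?_, by rw [Fin.sum_univ_two]; simp⟩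
  fin_cases j
  · exact ⟨h0, h1⟩
  · exact ⟨by simpa using h1, by simpa using h0⟩

lemma emb_profile {n : ℕ} {x : Fin n → ℝ} (hx : ∀ i, x i ∈ Set.Icc (0:ℝ) 1) :
    IsProfile (emb x) := fun i => div_of_mem (hx i)

lemma emb_of_profile {n : ℕ} {P : Fin n → Fin 2 → ℝ} (hP : IsProfile P) :
    emb (fun i => P i 0) = P := by
  funext i j
  fin_cases j
  · rfl
  · simp [emb, div_two (hP i)]

lemma emb_update {n : ℕ} (x : Fin n → ℝ) (i : Fin n) (a : ℝ) :
    emb (Function.update x i a) = Function.update (emb x) i ![a, 1 - a] := by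
  funext j
  by_cases h : j = i
  · subst h; simp [emb]
  · simp [emb, h]

lemma exists_perm_of_card {n : ℕ} (S T : Finset (Fin n)) (h : #S = #T) :
    ∃ σ : Equiv.Perm (Fin n), ∀ i, σ i ∈ S ↔ i ∈ T := by
  have e : {i // i ∈ T} ≃ {i // i ∈ S} := Fintype.equivOfCardEq (by simp [h])
  refine ⟨e.extendSubtype, fun i => ?_⟩
  constructor
  · intro hi
    by_contra hT
    exact e.extendSubtype_not_mem i hT hi
  · intro hi
    exact e.extendSubtype_mem i hi

/-- standard zero-one vector with `n - k` ones -/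
noncomputable def stdVec (n : ℕ) (k : ℕ) : Fin n → ℝ := fun i => if (i : ℕ) < n - k then 1 else 0

lemma ite01_mem (p : Prop) [Decidable p] : (if p then (1:ℝ) else 0) ∈ Set.Icc (0:ℝ) 1 := by
  split_ifs <;> simp

lemma update_mem {n : ℕ} {x : Fin n → ℝ} (hx : ∀ i, x i ∈ Set.Icc (0:ℝ) 1) (i : Fin n) {a : ℝ}
    (ha : a ∈ Set.Icc (0:ℝ) 1) (j : Fin n) : Function.update x i a j ∈ Set.Icc (0:ℝ) 1 := by
  by_cases h : j = i
  · subst h; simpa using ha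
  · simpa [h] using hx j

lemma card_lt_sub {n k : ℕ} (hk : k ≤ n) : #{i : Fin n | (i : ℕ) < n - k} = n - k := by
  rw [Fin.card_filter_val_lt]
  omega

lemma symMed_of_axioms {n : ℕ} (A : (Fin n → Fin 2 → ℝ) → (Fin 2 → ℝ)) (hA : ValidMech A)
    (hanon : Anonymous A) (hneut : Neutral A) (hcont : ContinuousOn A {P | IsProfile P})
    (hic : IncentiveCompatible A) : ∃ α, IsSymMed A α := by
  let g : (Fin n → ℝ) → ℝ := fun x => A (emb x) 0
  -- one-dimensional facts
  have hic1 : ∀ z : Fin n → ℝ, (∀ i, z i ∈ Set.Icc (0:ℝ) 1) → ∀ i, ∀ x ∈ Set.Icc (0:ℝ) 1,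
      ∀ y ∈ Set.Icc (0:ℝ) 1,
      |g (Function.update z i x) - x| ≤ |g (Function.update z i y) - x| := by
    intro z hz i x hx y hy
    have := hic (emb z) (emb_profile hz) i _ _ (div_of_mem hx) (div_of_mem hy)
    rw [← emb_update, ← emb_update,
      l1_two (hA _ (emb_profile (update_mem hz i hx))) (div_of_mem hx),
      l1_two (hA _ (emb_profile (update_mem hz i hy))) (div_of_mem hx)] at this
    simp only [Matrix.cons_val_zero] at this
    simp only [g]
    linarith
  have hc1 : ∀ z : Fin n → ℝ, (∀ i, z i ∈ Set.Icc (0:ℝ) 1) → ∀ i,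
      ContinuousOn (fun y => g (Function.update z i y)) (Set.Icc 0 1) := by
    intro z hz i
    have h1 : Continuous (fun y => emb (Function.update z i y)) := by
      apply continuous_pi; intro j
      apply continuous_pi; intro l
      have h2 : Continuous (fun y => Function.update z i y j) := by fun_prop
      fin_cases l
      · exact h2
      · exact continuous_const.sub h2
    have h3 := hcont.comp h1.continuousOn
      (fun y hy => emb_profile (update_mem hz i hy) : Set.MapsTo _ (Set.Icc (0:ℝ) 1) _)
    exact (continuousOn_pi.1 h3) 0
  have hmono1 : ∀ z : Fin n → ℝ, (∀ i, z i ∈ Set.Icc (0:ℝ) 1) → ∀ i, ∀ y ∈ Set.Icc (0:ℝ) 1,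
      (z i ≤ y → g z ≤ g (Function.update z i y)) ∧
      (y ≤ z i → g (Function.update z i y) ≤ g z) := by
    intro z hz i y hy
    have := one_dim_mono (fun y => g (Function.update z i y)) (hic1 z hz i)
    constructor
    · intro h
      simpa using this (hz i) hy h
    · intro h
      simpa using this hy (hz i) h
  have hmono : ∀ x y : Fin n → ℝ, (∀ i, x i ∈ Set.Icc (0:ℝ) 1) → (∀ i, y i ∈ Set.Icc (0:ℝ) 1) →
      (∀ i, x i ≤ y i) → g x ≤ g y := by
    intro x y hx hy hxy
    refine update_steps (fun z => g x ≤ g z) x y ?_ le_rfl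
    intro z i hz hzi hQ
    have hz' : ∀ i, z i ∈ Set.Icc (0:ℝ) 1 := fun j => by
      rcases hz j with h | h <;> rw [h]
      · exact hx j
      · exact hy j
    exact hQ.trans ((hmono1 z hz' i _ (hy i)).1 (by rw [hzi]; exact hxy i))
  -- low and high replacements
  have hlow : ∀ x : Fin n → ℝ, (∀ i, x i ∈ Set.Icc (0:ℝ) 1) →
      g x ≤ g (fun i => if g x ≤ x i then 1 else 0) := by
    intro x hx
    refine update_steps (fun z => g x ≤ g z) x _ ?_ le_rfl
    intro z i hz hzi hQ
    have hz' : ∀ i, z i ∈ Set.Icc (0:ℝ) 1 := fun j => by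
      rcases hz j with h | h <;> rw [h]
      · exact hx j
      · exact ite01_mem _
    by_cases hi : g x ≤ x i
    · simp only [hi, if_true]
      exact hQ.trans ((hmono1 z hz' i 1 (by simp)).1 (hz' i).2)
    · simp only [hi, if_false]
      exact one_dim_low (fun y => g (Function.update z i y)) (hc1 z hz' i) (hic1 z hz' i) (x i)
        (hx i) (g x) (not_le.1 hi) (by simpa [← hzi] using hQ)
  have hhigh : ∀ x : Fin n → ℝ, (∀ i, x i ∈ Set.Icc (0:ℝ) 1) →
      g (fun i => if g x < x i then 1 else 0) ≤ g x := by
    intro x hx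
    refine update_steps (fun z => g z ≤ g x) x _ ?_ le_rfl
    intro z i hz hzi hQ
    have hz' : ∀ i, z i ∈ Set.Icc (0:ℝ) 1 := fun j => by
      rcases hz j with h | h <;> rw [h]
      · exact hx j
      · exact ite01_mem _
    by_cases hi : g x < x i
    · simp only [hi, if_true]
      exact one_dim_high (fun y => g (Function.update z i y)) (hc1 z hz' i) (hic1 z hz' i) (x i)
        (hx i) (g x) hi (by simpa [← hzi] using hQ)
    · simp only [hi, if_false]
      exact ((hmono1 z hz' i 0 (by simp)).2 (hz' i).1).trans hQ
  -- anonymity on zero-one vectors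
  have hzo : ∀ (p : Fin n → Prop) [DecidablePred p] (k : ℕ), k + #{i | p i} = n →
      g (fun i => if p i then 1 else 0) = g (stdVec n k) := by
    intro p _ k hk
    obtain ⟨σ, hσ⟩ := exists_perm_of_card ({i | p i} : Finset (Fin n))
      ({i : Fin n | (i : ℕ) < n - k}) (by rw [card_lt_sub (by omega)]; omega)
    have h1 := hanon (emb (fun i => if p i then 1 else 0)) (emb_profile (fun i => ite01_mem _)) σ
    simp only [g]
    rw [← h1]
    congr 2
    funext i
    have := hσ i
    simp only [Finset.mem_filter, Finset.mem_univ, true_and] at this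
    simp only [Function.comp, emb, stdVec, this]
  have hstd : ∀ k i, stdVec n k i ∈ Set.Icc (0:ℝ) 1 := fun k i => ite01_mem _
  have hanti : Antitone (fun k : Fin (n + 1) => g (stdVec n k)) := by
    intro k l hkl
    refine hmono _ _ (hstd _) (hstd _) (fun i => ?_)
    have hkl' : (k : ℕ) ≤ l := hkl
    unfold stdVec
    split_ifs <;> first | omega | norm_num
  refine ⟨fun k => g (stdVec n k), hanti, fun k => (hA _ (emb_profile (hstd k))).1 0, ?_, ?_⟩
  · intro k
    have hk := k.2
    have h1 := hneut (emb (stdVec n k)) (emb_profile (hstd k)) (Equiv.swap 0 1)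
    have h2 := congrFun h1 0
    simp only [Equiv.swap_apply_left] at h2
    rw [div_two (hA _ (emb_profile (hstd k)))] at h2
    simp only [g] at *
    rw [← h2, ← hzo (fun i => ¬ ((i : ℕ) < n - k)) (Fin.rev k)]
    · congr 1
      congr 1
      funext i j
      fin_cases j
      · by_cases h : (i : ℕ) < n - k <;> simp [emb, stdVec, h]
      · by_cases h : (i : ℕ) < n - k <;> simp [emb, stdVec, h]
    · have h3 := Finset.card_filter_add_card_filter_not (s := (Finset.univ : Finset (Fin n)))
        (fun i : Fin n => (i : ℕ) < n - k)
      rw [card_lt_sub (by omega)] at h3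
      simp only [Finset.card_univ, Fintype.card_fin] at h3
      rw [Fin.val_rev]
      omega
  · intro P hP
    have hx : ∀ i, P i 0 ∈ Set.Icc (0:ℝ) 1 := fun i => (hP i).1 0
    have hg : A P 0 = g (fun i => P i 0) := by simp only [g, emb_of_profile hP]
    rw [hg]
    set x : Fin n → ℝ := fun i => P i 0 with hxdef
    have hcard : ∀ (p : Fin n → Prop) [DecidablePred p], #{i | p i} ≤ n := fun p _ => by
      simpa using Finset.card_le_univ ({i | p i} : Finset (Fin n))
    apply le_antisymm
    · have h1 := hcard (fun i => g x ≤ x i)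
      rw [le_gmed_anti _ hanti x (g x) ⟨n - #{i | g x ≤ x i}, by omega⟩ (by simp only; omega)]
      simp only
      rw [← hzo (fun i => g x ≤ x i) _ (by omega)]
      exact hlow x hx
    · have h1 := hcard (fun i => x i ≤ g x)
      rw [gmed_le_anti _ hanti x (g x) ⟨#{i | x i ≤ g x}, by omega⟩ rfl]
      simp only
      have h3 := Finset.card_filter_add_card_filter_not (s := (Finset.univ : Finset (Fin n)))
        (fun i : Fin n => x i ≤ g x)
      simp only [Finset.card_univ, Fintype.card_fin, not_le] at h3
      rw [← hzo (fun i => g x < x i) _ h3]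
      exact hhigh x hx

theorem moving_phantom_characterization_two (n : ℕ) (hn : 1 ≤ n)
    (A : (Fin n → Fin 2 → ℝ) → (Fin 2 → ℝ)) (hA : ValidMech A) :
    (Anonymous A ∧ Neutral A ∧ ContinuousOn A {P | IsProfile P} ∧ IncentiveCompatible A) ↔
      ∃ f : Fin (n + 1) → ℝ → ℝ, IsPhantomSystem n f ∧
        ∀ P : Fin n → Fin 2 → ℝ, IsProfile P → A P = AMP f P := by
  constructor
  · rintro ⟨h1, h2, h3, h4⟩
    obtain ⟨α, hα⟩ := symMed_of_axioms A hA h1 h2 h3 h4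
    exact phantom_of_symMed A hA α hα
  · rintro ⟨f, hf, h⟩
    obtain ⟨α, hα⟩ := symMed_of_phantom A hf h
    exact axioms_of_symMed A hA α hα
end

section
/- In the single-good market with n ≥ 1 voters with values v_1,…,v_n ∈ [0,∞) and supply x > 0, the market clearing price c equals med(0, 1/x, 2/x, …, n/x, v_1, …, v_n), the median of these 2n+1 numbers. -/
open Finset

theorem aux_sorted (p : ℝ) : ∀ (s : List ℝ) (_ : s.Pairwise (· ≤ ·)) (j : ℕ) (_ : j < s.length),
    p < s.getD j 0 ↔ s.countP (fun a => decide (a ≤ p)) ≤ j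
  | [], _, j, hj => by simp at hj
  | a :: t, hs, j, hj => by
    rw [List.pairwise_cons] at hs
    by_cases ha : a ≤ p
    · rw [List.countP_cons_of_pos (by simpa using ha)]
      cases j with
      | zero => simp [ha]
      | succ j =>
        have := aux_sorted p t hs.2 j (by simpa using hj)
        simp only [List.getD_cons_succ, this]
        omega
    · have h0 : (a :: t).countP (fun a => decide (a ≤ p)) = 0 := by
        rw [List.countP_eq_zero]
        intro b hb
        rcases List.mem_cons.1 hb with rfl | hb
        · simpa using ha
        · have := hs.1 b hb
          simp only [decide_eq_true_eq]
          intro h; exact ha (this.trans h)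
      rw [h0]
      simp only [Nat.zero_le, iff_true]
      rw [List.getD_eq_getElem _ _ hj]
      have := List.getElem_mem hj
      rcases List.mem_cons.1 this with h | h
      · rw [h]; exact not_le.1 ha
      · exact lt_of_lt_of_le (not_le.1 ha) (hs.1 _ h)

theorem aux_count (p : ℝ) : ∀ (n : ℕ) (f : Fin n → ℝ),
    (List.ofFn f).countP (fun a => decide (a ≤ p)) = ∑ i, if f i ≤ p then 1 else 0
  | 0, f => by simp
  | n + 1, f => by
    rw [List.ofFn_succ, List.countP_cons, aux_count p n, Fin.sum_univ_succ]
    simp [add_comm]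

theorem aux_med (n : ℕ) (l : List ℝ) (hl : l.length = 2 * n + 1) (p : ℝ) :
    p < medList l ↔ l.countP (fun a => decide (a ≤ p)) ≤ n := by
  unfold medList
  have hlen : (l.length - 1) / 2 = n := by omega
  rw [hlen, aux_sorted p _ (Multiset.pairwise_sort _ _) n (by simp; omega)]
  have hp : ((Multiset.ofList l).sort (· ≤ ·)).Perm l := by
    rw [← Multiset.coe_eq_coe, Multiset.sort_eq]
  rw [hp.countP_eq]

theorem aux_key (n : ℕ) (x : ℝ) (hx : 0 < x) (v : Fin n → ℝ) (p : ℝ) :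
    p < medList (List.ofFn (fun k : Fin (n + 1) => (k : ℝ) / x) ++ List.ofFn v) ↔
      x * p < ((Finset.univ.filter (fun i => p < v i)).card : ℝ) := by
  rw [aux_med n _ (by simp; omega), List.countP_append, aux_count, aux_count]
  have hB := Fin.sum_univ_eq_sum_range (fun k : ℕ => if (k : ℝ) / x ≤ p then 1 else 0) (n + 1)
  rw [hB, ← Finset.card_filter, ← Finset.card_filter]
  have hA := Finset.card_filter_add_card_filter_not (s := (Finset.univ : Finset (Fin n)))
    (fun i => p < v i)
  simp only [not_lt, Finset.card_univ, Fintype.card_fin] at hA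
  set A := (Finset.univ.filter (fun i => p < v i)).card
  have hd : ∀ k : ℕ, (k : ℝ) / x ≤ p ↔ (k : ℝ) ≤ x * p := fun k => by
    rw [div_le_iff₀ hx, mul_comm]
  constructor
  · intro h
    by_contra hc
    rw [not_lt] at hc
    have : Finset.range (A + 1) ⊆ (Finset.range (n + 1)).filter (fun k : ℕ => (k : ℝ) / x ≤ p) := by
      intro k hk
      rw [Finset.mem_range] at hk
      rw [Finset.mem_filter, Finset.mem_range, hd]
      refine ⟨by omega, le_trans ?_ hc⟩
      exact_mod_cast (by omega : k ≤ A)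
    have := Finset.card_le_card this
    rw [Finset.card_range] at this
    omega
  · intro h
    have : (Finset.range (n + 1)).filter (fun k : ℕ => (k : ℝ) / x ≤ p) ⊆ Finset.range A := by
      intro k hk
      rw [Finset.mem_filter, hd] at hk
      rw [Finset.mem_range]
      exact_mod_cast hk.2.trans_lt h
    have := Finset.card_le_card this
    rw [Finset.card_range] at this
    omega

/-- in the single-good market with supply `x > 0`, unit budgets, and values
`v i ≥ 0` (where voter `i` demands `1/π` at any price `0 < π < v i`, nothing at prices
`π ≥ v i` with `π > 0`, and infinitely much at `π = 0`), the market clearing price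
`c = sup {π ≥ 0 : total demand at π exceeds x}` equals the median of the `2n+1` numbers
`0, 1/x, …, n/x, v 1, …, v n`. -/
theorem market_clearing_median (n : ℕ) (hn : 1 ≤ n) (x : ℝ) (hx : 0 < x)
    (v : Fin n → ℝ) (hv : ∀ i, 0 ≤ v i) :
    sSup {π : ℝ | 0 ≤ π ∧ (π = 0 ∨ x < ∑ i, if π < v i then 1 / π else 0)}
      = medList (List.ofFn (fun k : Fin (n + 1) => (k : ℝ) / x) ++ List.ofFn v) := by
  have key := aux_key n x hx v
  set M := medList (List.ofFn (fun k : Fin (n + 1) => (k : ℝ) / x) ++ List.ofFn v)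
  have hM : 0 ≤ M := by
    by_contra h
    rw [not_le] at h
    have h2 := (key M).not.1 (lt_irrefl M)
    apply h2
    have : x * M < 0 := mul_neg_of_pos_of_neg hx h
    exact this.trans_le (Nat.cast_nonneg _)
  have hS : ∀ p : ℝ, 0 < p → ((x < ∑ i, if p < v i then 1 / p else 0) ↔ p < M) := by
    intro p hp
    rw [key p, ← Finset.sum_filter, Finset.sum_const, nsmul_eq_mul, mul_one_div, lt_div_iff₀ hp]
  have hub : ∀ p ∈ {π : ℝ | 0 ≤ π ∧ (π = 0 ∨ x < ∑ i, if π < v i then 1 / π else 0)}, p ≤ M := by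
    rintro p ⟨hp, h⟩
    rcases hp.eq_or_lt with h0 | h0
    · rw [← h0]; exact hM
    · rcases h with h | h
      · rw [h]; exact hM
      · exact ((hS p h0).1 h).le
  refine csSup_eq_of_forall_le_of_forall_lt_exists_gt ⟨0, le_refl _, Or.inl rfl⟩ hub ?_
  intro w hw
  rcases lt_or_ge w 0 with h | h
  · exact ⟨0, ⟨le_refl _, Or.inl rfl⟩, h⟩
  · obtain ⟨p, h1, h2⟩ := exists_between hw
    have h0 := h.trans_lt h1
    exact ⟨p, ⟨h0.le, Or.inr ((hS p h0).2 h2)⟩, h1⟩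
end
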